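/- Let Q be a finite acyclic quiver with path algebra A = kQ. Then the path algebra of Q tensored with its opposite algebra, A \otimes_k A^{op}, is isomorphic as a k-algebra to the quotient of the path algebra of the product quiver Q \times Q^{op} by the ideal I generated by all commutativity relations (\alpha,j)(i,\beta^*) - (i',\beta^*)(\alpha,j') for arrows \alpha: i \to i' and \beta: j \to j' in Q. -/

import Mathlib

/- STATEMENT 1: For a finite acyclic quiver Q with path algebra A = kQ, the algebra
A ⊗_k A^op is isomorphic as a k-algebra to the path algebra of the product quiver
Q × Q^op modulo the ideal generated by the commutativity relations
(α,j)(i,β*) - (i',β*)(α,j') for arrows α : i → i' and β : j → j' in Q.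

The path algebra of a quiver is realized faithfully as the subalgebra of endomorphisms of
the free module on all paths generated by the path-composition operators (multiplication
in function-composition order); the quotient by the ideal of commutativity relations is
realized via `RingQuot`. -/

set_option synthInstance.maxHeartbeats 1000000
set_option maxHeartbeats 2000000

open Quiver TensorProduct

/-- The index set of all paths in `Q`. -/
abbrev PIdx (Q : Type) [Quiver.{1} Q] := Σ a b : Q, Path a b

/-- The underlying vector space of the path algebra: the free `k`-module on all paths. -/
abbrev PASpace (k : Type) [Field k] (Q : Type) [Quiver.{1} Q] := PIdx Q →₀ k

/-- Partial composition of paths (function-composition order). -/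
def pcomp {Q : Type} [Quiver.{1} Q] [DecidableEq Q] (p q : PIdx Q) : Option (PIdx Q) :=
  if h : q.2.1 = p.1 then some ⟨q.1, p.2.1, (q.2.2).comp (p.2.2.cast h.symm rfl)⟩ else none

/-- The operator of composition with the path `p`. -/
noncomputable def pathOp (k : Type) [Field k] (Q : Type) [Quiver.{1} Q] [DecidableEq Q]
    (p : PIdx Q) : Module.End k (PASpace k Q) :=
  Finsupp.lsum k fun q => match pcomp p q with
    | some r => Finsupp.lsingle r
    | none => 0

/-- The path algebra `kQ`. -/
noncomputable def PathAlg (k : Type) [Field k] (Q : Type) [Quiver.{1} Q] [DecidableEq Q] :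
    Subalgebra k (Module.End k (PASpace k Q)) :=
  Algebra.adjoin k (Set.range (pathOp k Q))

/-- The product quiver `Q × Q^op`: vertices are pairs of vertices of `Q`, with arrows
`(α,j) : (i,j) → (i',j)` for `α : i → i'` in `Q`, and `(i,α*) : (i,j') → (i,j)` for
`α : j → j'` in `Q`. -/
def ProdQ (Q : Type) := Q × Q

instance prodQuiver (Q : Type) [Quiver.{1} Q] : Quiver.{1} (ProdQ Q) :=
  ⟨fun x y => ((x.1 ⟶ y.1) × PLift (x.2 = y.2)) ⊕ ((y.2 ⟶ x.2) × PLift (x.1 = y.1))⟩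

instance (Q : Type) [DecidableEq Q] : DecidableEq (ProdQ Q) :=
  instDecidableEqProd

/-- The arrow `(α, j) : (i,j) → (i',j)` of `Q × Q^op`. -/
def arrL {Q : Type} [Quiver.{1} Q] {i i' : Q} (α : i ⟶ i') (j : Q) :
    @Quiver.Hom (ProdQ Q) _ (i, j) (i', j) :=
  Sum.inl (α, PLift.up rfl)

/-- The arrow `(i, β*) : (i,j') → (i,j)` of `Q × Q^op` for `β : j → j'` in `Q`. -/
def arrR {Q : Type} [Quiver.{1} Q] (i : Q) {j j' : Q} (β : j ⟶ j') :
    @Quiver.Hom (ProdQ Q) _ (i, j') (i, j) :=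
  Sum.inr (β, PLift.up rfl)

/-- The generator of the path algebra of `Q × Q^op` corresponding to an arrow. -/
noncomputable def gen (k : Type) [Field k] (Q : Type) [Quiver.{1} Q] [DecidableEq Q]
    {x y : ProdQ Q} (a : x ⟶ y) : ↥(PathAlg k (ProdQ Q)) :=
  ⟨pathOp k (ProdQ Q) ⟨x, y, a.toPath⟩, Algebra.subset_adjoin (Set.mem_range_self _)⟩

/-- The commutativity relations `(α,j)(i,β*) = (i',β*)(α,j')` generating the ideal `I`. -/
def commRel (k : Type) [Field k] (Q : Type) [Quiver.{1} Q] [DecidableEq Q] :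
    ↥(PathAlg k (ProdQ Q)) → ↥(PathAlg k (ProdQ Q)) → Prop :=
  fun x y => ∃ (i i' j j' : Q) (α : i ⟶ i') (β : j ⟶ j'),
    x = gen k Q (arrL α j) * gen k Q (arrR i β) ∧
    y = gen k Q (arrR i' β) * gen k Q (arrL α j')

section General
variable (k : Type) [Field k] {V : Type} [Quiver.{1} V] [DecidableEq V]

theorem pathOp_single_comp {a b c : V} (p : Path b c) (q : Path a b) (r : k) :
    pathOp k V ⟨b, c, p⟩ (Finsupp.single ⟨a, b, q⟩ r) = Finsupp.single ⟨a, c, q.comp p⟩ r := by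
  simp [pathOp, pcomp]

theorem pathOp_single_ne {a b b' c : V} (h : b ≠ b') (p : Path b' c) (q : Path a b) (r : k) :
    pathOp k V ⟨b', c, p⟩ (Finsupp.single ⟨a, b, q⟩ r) = 0 := by
  simp [pathOp, pcomp, h]

/-- The element of the path algebra given by a path. -/
noncomputable def pathEl {a b : V} (p : Path a b) : ↥(PathAlg k V) :=
  ⟨pathOp k V ⟨a, b, p⟩, Algebra.subset_adjoin (Set.mem_range_self _)⟩

theorem pathEl_mul {a b c : V} (p : Path b c) (q : Path a b) :
    pathEl k p * pathEl k q = pathEl k (q.comp p) := by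
  apply Subtype.ext
  apply Finsupp.lhom_ext
  rintro ⟨x, y, s⟩ r
  change pathOp k V _ (pathOp k V _ _) = pathOp k V _ _
  by_cases h : y = a
  · subst h
    rw [pathOp_single_comp, pathOp_single_comp, pathOp_single_comp, Path.comp_assoc]
  · rw [pathOp_single_ne k h, pathOp_single_ne k h, map_zero]

theorem pathEl_mul_ne {a b b' c : V} (hb : b ≠ b') (p : Path b' c) (q : Path a b) :
    pathEl k p * pathEl k q = 0 := by
  apply Subtype.ext
  apply Finsupp.lhom_ext
  rintro ⟨x, y, s⟩ r
  change pathOp k V _ (pathOp k V _ _) = 0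
  by_cases h : y = a
  · subst h
    rw [pathOp_single_comp, pathOp_single_ne k hb]
  · rw [pathOp_single_ne k h, map_zero]

theorem pathEl_one [Fintype V] : (1 : ↥(PathAlg k V)) = ∑ v : V, pathEl k (Path.nil : Path v v) := by
  apply Subtype.ext
  apply Finsupp.lhom_ext
  rintro ⟨x, y, s⟩ r
  rw [AddSubmonoidClass.coe_finsetSum, LinearMap.sum_apply, Finset.sum_eq_single y]
  · change _ = pathOp k V _ _
    rw [pathOp_single_comp]
    rfl
  · intro b _ hb
    exact pathOp_single_ne k (Ne.symm hb) _ _ _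
  · simp

/-- Path elements indexed by the type of all paths. -/
noncomputable def pathFam (p : PIdx V) : ↥(PathAlg k V) := pathEl k p.2.2

theorem pathFam_li [Fintype V] : LinearIndependent k (pathFam k (V := V)) := by
  let f : ↥(PathAlg k V) →ₗ[k] PASpace k V :=
    (LinearMap.applyₗ (∑ v : V, Finsupp.single (⟨v, v, Path.nil⟩ : PIdx V) (1 : k))) ∘ₗ
      (PathAlg k V).val.toLinearMap
  refine LinearIndependent.of_comp f ?_
  have : f ∘ pathFam k = (Finsupp.basisSingleOne : Module.Basis (PIdx V) k (PIdx V →₀ k)) := by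
    funext p
    obtain ⟨a, b, p⟩ := p
    rw [Finsupp.coe_basisSingleOne]
    change pathOp k V ⟨a, b, p⟩ (∑ v : V, Finsupp.single (⟨v, v, Path.nil⟩ : PIdx V) (1 : k)) = _
    rw [map_sum, Finset.sum_eq_single a]
    · rw [pathOp_single_comp, Path.nil_comp]
    · intro v _ hv
      exact pathOp_single_ne k hv _ _ _
    · simp
  rw [this]
  exact Module.Basis.linearIndependent _

theorem pathFam_span [Fintype V] : ⊤ ≤ Submodule.span k (Set.range (pathFam k (V := V))) := by
  rintro ⟨x, hx⟩ -
  induction hx using Algebra.adjoin_induction with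
  | mem x hx => 
    obtain ⟨p, rfl⟩ := hx
    exact Submodule.subset_span ⟨p, rfl⟩
  | algebraMap r =>
    have : (⟨algebraMap k _ r, Subalgebra.algebraMap_mem _ r⟩ : ↥(PathAlg k V))
        = r • ∑ v : V, pathEl k (Path.nil : Path v v) := by
      rw [← pathEl_one, ← Algebra.algebraMap_eq_smul_one]; rfl
    rw [this]
    exact Submodule.smul_mem _ _ (Submodule.sum_mem _ fun v _ =>
      Submodule.subset_span ⟨⟨v, v, Path.nil⟩, rfl⟩)
  | add x y hx hy h1 h2 => exact Submodule.add_mem _ h1 h2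
  | mul x y hx hy h1 h2 =>
    change (⟨x, hx⟩ * ⟨y, hy⟩ : ↥(PathAlg k V)) ∈ _
    have := Submodule.mul_mem_mul h1 h2
    rw [Submodule.span_mul_span] at this
    refine (Submodule.span_le.2 ?_) this
    rintro _ ⟨_, ⟨⟨b', c, p⟩, rfl⟩, _, ⟨⟨a, b, q⟩, rfl⟩, rfl⟩
    change pathEl k p * pathEl k q ∈ Submodule.span k _
    by_cases h : b = b'
    · subst h
      rw [pathEl_mul]
      exact Submodule.subset_span ⟨⟨a, c, _⟩, rfl⟩
    · rw [pathEl_mul_ne k h]; exact Submodule.zero_mem _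

/-- The basis of paths. -/
noncomputable def pathBasis [Fintype V] : Module.Basis (PIdx V) k ↥(PathAlg k V) :=
  Module.Basis.mk (pathFam_li k) (pathFam_span k)

theorem pathBasis_apply [Fintype V] {a b : V} (p : Path a b) :
    pathBasis k ⟨a, b, p⟩ = pathEl k p := by
  rw [pathBasis, Module.Basis.mk_apply]; rfl

theorem map_mul_of_basis {A B ι : Type*} [Semiring A] [Semiring B] [Algebra k A] [Algebra k B]
    (b : Module.Basis ι k A) (f : A →ₗ[k] B)
    (h : ∀ i j, f (b i * b j) = f (b i) * f (b j)) (x y : A) : f (x * y) = f x * f y := by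
  revert x y
  rw [LinearMap.map_mul_iff]
  exact b.ext fun i => b.ext fun j => h i j

end General

section Prod
variable {Q : Type} [Quiver.{1} Q]

instance (Q : Type) [Fintype Q] : Fintype (ProdQ Q) := inferInstanceAs (Fintype (Q × Q))

/-- First projection of a path. -/
def fstP {x : ProdQ Q} : ∀ {y : ProdQ Q}, Path x y → Path x.1 y.1
  | _, Path.nil => Path.nil
  | _, Path.cons p (Sum.inl e) => (fstP p).cons e.1
  | _, Path.cons p (Sum.inr e) => (fstP p).cast rfl e.2.down

/-- Second projection of a path. -/
def sndP {x : ProdQ Q} : ∀ {y : ProdQ Q}, Path x y → Path y.2 x.2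
  | _, Path.nil => Path.nil
  | _, Path.cons p (Sum.inl e) => (sndP p).cast e.2.down rfl
  | _, Path.cons p (Sum.inr e) => (Hom.toPath e.1).comp (sndP p)

/-- Induction principle for arrows of the product quiver. -/
theorem arr_cases {motive : ∀ {x y : ProdQ Q}, (x ⟶ y) → Prop}
    (hL : ∀ {i i' : Q} (α : i ⟶ i') (j : Q), motive (arrL α j))
    (hR : ∀ (i : Q) {j j' : Q} (β : j ⟶ j'), motive (arrR i β))
    {x y : ProdQ Q} (e : x ⟶ y) : motive e := by
  obtain ⟨x1, x2⟩ := x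
  obtain ⟨y1, y2⟩ := y
  rcases e with ⟨α, ⟨h⟩⟩ | ⟨β, ⟨h⟩⟩
  · dsimp only at h; subst h; exact hL α _
  · dsimp only at h; subst h; exact hR _ β

theorem fstP_arrL {x : ProdQ Q} {i i' j : Q} (p : @Path (ProdQ Q) _ x (i, j)) (α : i ⟶ i') :
    fstP (p.cons (arrL α j)) = (fstP p).cons α := rfl
theorem fstP_arrR {x : ProdQ Q} {i j j' : Q} (p : @Path (ProdQ Q) _ x (i, j')) (β : j ⟶ j') :
    fstP (p.cons (arrR i β)) = fstP p := rfl
theorem sndP_arrL {x : ProdQ Q} {i i' j : Q} (p : @Path (ProdQ Q) _ x (i, j)) (α : i ⟶ i') :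
    sndP (p.cons (arrL α j)) = sndP p := rfl
theorem sndP_arrR {x : ProdQ Q} {i j j' : Q} (p : @Path (ProdQ Q) _ x (i, j')) (β : j ⟶ j') :
    sndP (p.cons (arrR i β)) = (Hom.toPath β).comp (sndP p) := rfl

theorem fstP_comp {x y z : ProdQ Q} (p : Path x y) (q : Path y z) :
    fstP (p.comp q) = (fstP p).comp (fstP q) := by
  induction q with
  | nil => rfl
  | cons q e ih =>
    revert q
    refine arr_cases (motive := fun {u v} e => ∀ (q : Path y u),
      fstP (p.comp q) = (fstP p).comp (fstP q) →
      fstP (p.comp (q.cons e)) = (fstP p).comp (fstP (q.cons e))) ?_ ?_ e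
    · intro i i' α j q ih
      erw [Path.comp_cons, fstP_arrL, fstP_arrL, ih, Path.comp_cons]
    · intro i j j' β q ih
      erw [Path.comp_cons, fstP_arrR, fstP_arrR, ih]

theorem sndP_comp {x y z : ProdQ Q} (p : Path x y) (q : Path y z) :
    sndP (p.comp q) = (sndP q).comp (sndP p) := by
  induction q with
  | nil => exact (Path.nil_comp _).symm
  | cons q e ih =>
    revert q
    refine arr_cases (motive := fun {u v} e => ∀ (q : Path y u),
      sndP (p.comp q) = (sndP q).comp (sndP p) →
      sndP (p.comp (q.cons e)) = (sndP (q.cons e)).comp (sndP p)) ?_ ?_ e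
    · intro i i' α j q ih
      erw [Path.comp_cons, sndP_arrL, sndP_arrL, ih]
    · intro i j j' β q ih
      erw [Path.comp_cons, sndP_arrR, sndP_arrR, ih, Path.comp_assoc]

/-- The horizontal path. -/
def pathL {a : Q} (j : Q) : ∀ {b : Q}, Path a b → @Path (ProdQ Q) _ (a, j) (b, j)
  | _, Path.nil => Path.nil
  | _, Path.cons p α => (pathL j p).cons (arrL α j)

/-- The vertical path. -/
def pathR (i : Q) {c : Q} : ∀ {d : Q}, Path c d → @Path (ProdQ Q) _ (i, d) (i, c)
  | _, Path.nil => Path.nil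
  | _, Path.cons p β => (Hom.toPath (arrR i β)).comp (pathR i p)

theorem pathR_comp (i : Q) {c d e : Q} (p : Path c d) (q : Path d e) :
    pathR i (p.comp q) = (pathR i q).comp (pathR i p) := by
  induction q with
  | nil => exact (Path.nil_comp _).symm
  | cons q β ih =>
    erw [Path.comp_cons, pathR, pathR, ih, Path.comp_assoc]

theorem fstP_pathL {a b : Q} (j : Q) (p : Path a b) : fstP (pathL j p) = p := by
  induction p with
  | nil => rfl
  | cons p α ih => erw [pathL, fstP_arrL, ih]

theorem sndP_pathL {a b : Q} (j : Q) (p : Path a b) : sndP (pathL j p) = Path.nil := by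
  induction p with
  | nil => rfl
  | cons p α ih => erw [pathL, sndP_arrL, ih]

theorem fstP_pathR {c d : Q} (i : Q) (p : Path c d) : fstP (pathR i p) = Path.nil := by
  induction p with
  | nil => rfl
  | cons p α ih => erw [pathR, fstP_comp, ih]; rfl

theorem sndP_pathR {c d : Q} (i : Q) (p : Path c d) : sndP (pathR i p) = p := by
  induction p with
  | nil => rfl
  | cons p α ih => erw [pathR, sndP_comp, ih]; rfl

/-- The normal form path. -/
def nf {a b c d : Q} (p : Path a b) (q : Path c d) : @Path (ProdQ Q) _ (a, d) (b, c) :=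
  (pathR a q).comp (pathL c p)

theorem fstP_nf {a b c d : Q} (p : Path a b) (q : Path c d) : fstP (nf p q) = p := by
  erw [nf, fstP_comp, fstP_pathL, fstP_pathR, Path.nil_comp]

theorem sndP_nf {a b c d : Q} (p : Path a b) (q : Path c d) : sndP (nf p q) = q := by
  erw [nf, sndP_comp, sndP_pathL, sndP_pathR, Path.nil_comp]

variable (k : Type) [Field k] [DecidableEq Q]

/-- Class of a path in the quotient. -/
noncomputable def mkP {x y : ProdQ Q} (p : Path x y) : RingQuot (commRel k Q) :=
  RingQuot.mkAlgHom k (commRel k Q) (pathEl k p)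

theorem mkP_comp {x y z : ProdQ Q} (p : Path x y) (q : Path y z) :
    mkP k (p.comp q) = mkP k q * mkP k p := by
  erw [mkP, ← pathEl_mul, map_mul]; rfl

theorem mkP_cons {x y z : ProdQ Q} (p : Path x y) (e : y ⟶ z) :
    mkP k (p.cons e) = mkP k (Hom.toPath e) * mkP k p := mkP_comp k p (Hom.toPath e)

theorem mkP_rel {i i' j j' : Q} (α : i ⟶ i') (β : j ⟶ j') :
    mkP k (Hom.toPath (arrR i' β)) * mkP k (Hom.toPath (arrL α j')) =
    mkP k (Hom.toPath (arrL α j)) * mkP k (Hom.toPath (arrR i β)) := by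
  have h : commRel k Q (gen k Q (arrL α j) * gen k Q (arrR i β))
    (gen k Q (arrR i' β) * gen k Q (arrL α j')) := ⟨i, i', j, j', α, β, rfl, rfl⟩
  have := RingQuot.mkAlgHom_rel k h
  erw [map_mul, map_mul] at this
  exact this.symm

theorem swap_aux {R : Type*} [Semigroup R] {r r' r'' l l' m m' n n' : R}
    (h1 : n = l * m) (h2 : n' = l' * m') (h3 : r * l = l' * r') (h4 : r' * m = m' * r'') :
    r * n = n' * r'' := by
  rw [h1, h2, ← mul_assoc, h3, mul_assoc, h4, mul_assoc]

theorem swap_aux2 {R : Type*} [Semigroup R] {s t r r' l l' m n n' : R}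
    (h1 : n = l * m) (h2 : m = r * s) (h3 : t * n' = l * r)
    (h4 : n' * s = l') (h5 : r' = t * l') : n = r' := by
  rw [h5, ← h4, ← mul_assoc, h3, h1, h2, mul_assoc]

theorem mkP_swap {a b c d : Q} (p : Path a b) (β : c ⟶ d) :
    mkP k (Hom.toPath (arrR b β)) * mkP k (pathL d p) =
    mkP k (pathL c p) * mkP k (Hom.toPath (arrR a β)) := by
  induction p with
  | nil =>
    exact (mkP_comp k (Path.nil : @Path (ProdQ Q) _ (a, d) (a, d)) (Hom.toPath (arrR a β))).symm.trans
      (mkP_comp k (Hom.toPath (arrR a β)) (Path.nil : @Path (ProdQ Q) _ (a, c) (a, c)))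
  | cons p α ih =>
    have h1 := mkP_cons k (pathL d p) (arrL α d)
    have h2 := mkP_cons k (pathL c p) (arrL α c)
    exact swap_aux h1 h2 (mkP_rel k α β) ih

theorem mkP_nf {x y : ProdQ Q} (P : Path x y) : mkP k (nf (fstP P) (sndP P)) = mkP k P := by
  induction P with
  | nil => rfl
  | cons q e ih =>
    revert q
    refine arr_cases (motive := fun {u v} e => ∀ (q : Path x u),
      mkP k (nf (fstP q) (sndP q)) = mkP k q →
      mkP k (nf (fstP (q.cons e)) (sndP (q.cons e))) = mkP k (q.cons e)) ?_ ?_ e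
    · intro i i' α j q ih
      have h1 := mkP_cons k (nf (fstP q) (sndP q)) (arrL α j)
      have h2 := mkP_cons k q (arrL α j)
      exact h1.trans ((congrArg (fun z => mkP k (Hom.toPath (arrL α j)) * z) ih).trans h2.symm)
    · intro i j j' β q ih
      have h2 := mkP_cons k q (arrR i β)
      have h0 := congrArg (mkP k) (pathR_comp x.1 (Hom.toPath β) (sndP q))
      have h3 := mkP_comp k (pathR x.1 (sndP q)) (Hom.toPath (arrR x.1 β))
      have h4 := mkP_comp k (pathR x.1 ((Hom.toPath β).comp (sndP q))) (pathL j (fstP q))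
      have h5 := mkP_comp k (pathR x.1 (sndP q)) (pathL j' (fstP q))
      exact swap_aux2 h4 (h0.trans h3) (mkP_swap k (fstP q) β) (h5.symm.trans ih) h2

variable [Fintype Q]

/-- The linear map to the tensor product. -/
noncomputable def phiLin :
    ↥(PathAlg k (ProdQ Q)) →ₗ[k] (↥(PathAlg k Q) ⊗[k] (↥(PathAlg k Q))ᵐᵒᵖ) :=
  (pathBasis k).constr k fun P => pathEl k (fstP P.2.2) ⊗ₜ MulOpposite.op (pathEl k (sndP P.2.2))

theorem phiLin_pathEl {x y : ProdQ Q} (P : Path x y) :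
    phiLin k (pathEl k P) = pathEl k (fstP P) ⊗ₜ MulOpposite.op (pathEl k (sndP P)) := by
  rw [← pathBasis_apply, phiLin, Module.Basis.constr_basis]

theorem op_sum' {A ι : Type*} [NonUnitalNonAssocSemiring A] [Fintype ι] (f : ι → A) :
    MulOpposite.op (∑ i, f i) = ∑ i, MulOpposite.op (f i) :=
  map_sum (MulOpposite.opAddEquiv (α := A)) f Finset.univ

theorem phiLin_one : phiLin k (1 : ↥(PathAlg k (ProdQ Q))) = 1 := by
  rw [pathEl_one, map_sum, Algebra.TensorProduct.one_def, ← MulOpposite.op_one, pathEl_one,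
    op_sum', TensorProduct.sum_tmul]
  simp_rw [TensorProduct.tmul_sum, phiLin_pathEl]
  exact Fintype.sum_prod_type (fun v : Q × Q => pathEl k (Path.nil : Path v.1 v.1) ⊗ₜ[k]
    MulOpposite.op (pathEl k (Path.nil : Path v.2 v.2)))

theorem phiLin_mul (x y : ↥(PathAlg k (ProdQ Q))) :
    phiLin k (x * y) = phiLin k x * phiLin k y := by
  refine map_mul_of_basis k (pathBasis k (V := ProdQ Q)) (phiLin k) ?_ x y
  rintro ⟨b', c, p⟩ ⟨a, b, q⟩
  rw [pathBasis_apply, pathBasis_apply]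
  rw [phiLin_pathEl, phiLin_pathEl, Algebra.TensorProduct.tmul_mul_tmul, ← MulOpposite.op_mul]
  by_cases h : b = b'
  · subst h
    rw [pathEl_mul, phiLin_pathEl, fstP_comp, sndP_comp, pathEl_mul, pathEl_mul]
  · rw [pathEl_mul_ne k h, map_zero]
    by_cases h1 : b.1 = b'.1
    · have h2 : b'.2 ≠ b.2 := fun h2 => h (Prod.ext h1 h2.symm)
      rw [pathEl_mul_ne k h2, MulOpposite.op_zero, TensorProduct.tmul_zero]
    · rw [pathEl_mul_ne k h1, TensorProduct.zero_tmul]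

/-- The algebra map from the quotient. -/
noncomputable def phi :
    RingQuot (commRel k Q) →ₐ[k] (↥(PathAlg k Q) ⊗[k] (↥(PathAlg k Q))ᵐᵒᵖ) :=
  RingQuot.liftAlgHom k ⟨AlgHom.ofLinearMap (phiLin k) (phiLin_one k) (phiLin_mul k), by
    rintro _ _ ⟨i, i', j, j', α, β, rfl, rfl⟩
    change phiLin k (pathEl k _ * pathEl k _) = phiLin k (pathEl k _ * pathEl k _)
    erw [pathEl_mul, pathEl_mul, phiLin_pathEl, phiLin_pathEl]
    rfl⟩

theorem phi_mkP {x y : ProdQ Q} (P : Path x y) :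
    phi k (mkP k P) = pathEl k (fstP P) ⊗ₜ MulOpposite.op (pathEl k (sndP P)) := by
  rw [phi, mkP, RingQuot.liftAlgHom_mkAlgHom_apply]
  exact phiLin_pathEl k P

/-- The basis of the tensor product. -/
noncomputable def tBasis :
    Module.Basis (PIdx Q × PIdx Q) k (↥(PathAlg k Q) ⊗[k] (↥(PathAlg k Q))ᵐᵒᵖ) :=
  (pathBasis k).tensorProduct ((pathBasis k).map (MulOpposite.opLinearEquiv k))

theorem tBasis_apply {a b c d : Q} (p : Path a b) (q : Path c d) :
    tBasis k (⟨a, b, p⟩, ⟨c, d, q⟩) = pathEl k p ⊗ₜ MulOpposite.op (pathEl k q) := by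
  rw [tBasis, Module.Basis.tensorProduct_apply, Module.Basis.map_apply, pathBasis_apply,
    pathBasis_apply]
  rfl

/-- The inverse linear map. -/
noncomputable def psi :
    (↥(PathAlg k Q) ⊗[k] (↥(PathAlg k Q))ᵐᵒᵖ) →ₗ[k] RingQuot (commRel k Q) :=
  (tBasis k).constr k fun P => mkP k (nf P.1.2.2 P.2.2.2)

theorem psi_tmul {a b c d : Q} (p : Path a b) (q : Path c d) :
    psi k (pathEl k p ⊗ₜ MulOpposite.op (pathEl k q)) = mkP k (nf p q) := by
  rw [← tBasis_apply, psi, Module.Basis.constr_basis]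

theorem psi_phi (z : RingQuot (commRel k Q)) : psi k (phi k z) = z := by
  obtain ⟨z, rfl⟩ := RingQuot.mkAlgHom_surjective k (commRel k Q) z
  have : psi k ∘ₗ (phi k).toLinearMap ∘ₗ (RingQuot.mkAlgHom k (commRel k Q)).toLinearMap =
      (RingQuot.mkAlgHom k (commRel k Q)).toLinearMap := by
    refine (pathBasis k).ext ?_
    rintro ⟨x, y, P⟩
    rw [pathBasis_apply]
    change psi k (phi k (mkP k P)) = mkP k P
    rw [phi_mkP, psi_tmul, mkP_nf]
  exact LinearMap.congr_fun this z

theorem phi_psi (z : ↥(PathAlg k Q) ⊗[k] (↥(PathAlg k Q))ᵐᵒᵖ) : phi k (psi k z) = z := by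
  have : (phi k (Q := Q)).toLinearMap ∘ₗ psi k (Q := Q) = LinearMap.id := by
    refine (tBasis k (Q := Q)).ext ?_
    rintro ⟨⟨a, b, p⟩, ⟨c, d, q⟩⟩
    rw [tBasis_apply]
    change phi k (psi k _) = _
    rw [psi_tmul]
    refine (phi_mkP k (nf p q)).trans ?_
    erw [fstP_nf, sndP_nf]
    rfl
  exact LinearMap.congr_fun this z

end Prod

/-- For a finite acyclic quiver `Q`, the algebra `A ⊗_k A^op` (for
`A = kQ`) is isomorphic as a `k`-algebra to `k(Q × Q^op)/I`, the path algebra of the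
product quiver modulo the ideal of commutativity relations. -/
theorem pathAlg_tensor_op_iso (k : Type) [Field k] (Q : Type) [Quiver.{1} Q] [DecidableEq Q]
    [Fintype Q] [∀ a b : Q, Fintype (a ⟶ b)]
    (hacyclic : ∀ (a : Q) (p : Path a a), p = Path.nil) :
    Nonempty ((↥(PathAlg k Q) ⊗[k] (↥(PathAlg k Q))ᵐᵒᵖ) ≃ₐ[k] RingQuot (commRel k Q)) := by
  exact ⟨(AlgEquiv.ofBijective (phi k (Q := Q))
    ⟨Function.LeftInverse.injective (psi_phi k), Function.RightInverse.surjective (phi_psi k)⟩).symm⟩
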